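/- arXiv:1609.01780 — 2 statements merged into one kernel-verified Lean document; each statement's English description precedes it below -/
import Mathlib

section
/- Let $u\in\mathcal{S}'(\mathbb{R}^d)$ have Fourier transform supported in $\{\xi:|\xi|<t\}$ for some $t>0$, and let $0<r<\infty$. Then for every $x\in\mathbb{R}^d$, $\sup_{z\in\mathbb{R}^d} \dfrac{|u(x-z)|}{(1+t|z|)^{d/r}} \le C(d,r)\,\big(\mathcal{M}(|u|^r)(x)\big)^{1/r}$, where $\mathcal{M}$ is the Hardy–Littlewood maximal function. In particular no a priori growth assumption on $u$ is required. -/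
open MeasureTheory
open scoped ENNReal RealInnerProductSpace

noncomputable abbrev Ed (d : ℕ) := EuclideanSpace ℝ (Fin d)

/-- The Fourier transform in the convention `f̂(ξ) = ∫ f(x) e^{-i x·ξ} dx`. -/
noncomputable def pFT {d : ℕ} (f : Ed d → ℂ) (ξ : Ed d) : ℂ :=
  ∫ x : Ed d, Complex.exp (-(Complex.I) * ((⟪x, ξ⟫ : ℝ) : ℂ)) * f x

/-- The centered Hardy–Littlewood maximal function, valued in `ℝ≥0∞`. -/
noncomputable def maxFn {d : ℕ} (f : Ed d → ℝ) (x : Ed d) : ℝ≥0∞ :=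
  ⨆ (ρ : ℝ) (_ : 0 < ρ),
    (∫⁻ y in Metric.ball x ρ, ENNReal.ofReal |f y| ∂volume) / volume (Metric.ball x ρ)

lemma pFT_modulate {d : ℕ} (f : Ed d → ℂ) (x y : Ed d) {a : ℝ} (ha : 0 < a) :
    pFT (fun ξ => Complex.exp (Complex.I * ((⟪ξ, x⟫ : ℝ) : ℂ)) * f (a • ξ)) y =
      ((a ^ d)⁻¹ : ℝ) • pFT f (a⁻¹ • (y - x)) := by
  have h := Measure.integral_comp_smul_of_nonneg (volume : Measure (Ed d))
    (fun η => Complex.exp (-(Complex.I) * ((⟪η, a⁻¹ • (y - x)⟫ : ℝ) : ℂ)) * f η) a (hR := ha.le)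
  rw [finrank_euclideanSpace_fin] at h
  rw [pFT, pFT, ← h]
  congr 1 with ξ
  rw [← mul_assoc, ← Complex.exp_add]
  congr 2
  rw [real_inner_smul_left, real_inner_smul_right, inner_sub_right, ← mul_assoc,
    mul_inv_cancel₀ ha.ne']
  push_cast
  ring

lemma integral_mul_dilate {d : ℕ} (u G : Ed d → ℂ) (x : Ed d) {a : ℝ} (ha : 0 < a) :
    ∫ y, u y * (((a ^ d)⁻¹ : ℝ) • G (a⁻¹ • (y - x))) = ∫ w, u (x + a • w) * G w := by
  have h := Measure.integral_comp_smul_of_nonneg (volume : Measure (Ed d))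
    (fun η => u (x + η) * G (a⁻¹ • η)) a (hR := ha.le)
  rw [finrank_euclideanSpace_fin] at h
  simp only [inv_smul_smul₀ ha.ne'] at h
  rw [h, ← integral_add_left_eq_self _ x, ← integral_smul]
  simp [mul_left_comm]

lemma pFT_eq_fourier {d : ℕ} (f : Ed d → ℂ) (y : Ed d) :
    pFT f y = FourierTransform.fourier f ((2 * Real.pi)⁻¹ • y) := by
  rw [Real.fourier_eq', pFT]
  congr 1 with x
  rw [smul_eq_mul, real_inner_smul_right]
  congr 2
  push_cast
  have : (Real.pi : ℂ) ≠ 0 := by exact_mod_cast Real.pi_ne_zero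
  field_simp

lemma exists_cutoff (d : ℕ) : ∃ (ψ : Ed d → ℂ) (G : SchwartzMap (Ed d) ℂ),
    ContDiff ℝ (⊤ : ℕ∞) ψ ∧ HasCompactSupport ψ ∧ (∀ ξ, ‖ξ‖ ≤ 1 → ψ ξ = 1) ∧
    (∀ y, G y = pFT ψ y) ∧ ∫ y, G y ≠ 0 := by
  let b : ContDiffBump (0 : Ed d) := ⟨1, 2, one_pos, one_lt_two⟩
  have hs : ContDiff ℝ (⊤ : ℕ∞) (fun ξ => (b ξ : ℂ)) :=
    Complex.ofRealCLM.contDiff.comp b.contDiff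
  have hc : HasCompactSupport (fun ξ => (b ξ : ℂ)) :=
    b.hasCompactSupport.comp_left (g := fun s : ℝ => (s : ℂ)) (by simp)
  let P : SchwartzMap (Ed d) ℂ := hc.toSchwartzMap hs
  have hπ : (2 * Real.pi)⁻¹ ≠ 0 := by positivity
  let e : Ed d ≃L[ℝ] Ed d := ContinuousLinearEquiv.smulLeft (Units.mk0 _ hπ)
  let F : SchwartzMap (Ed d) ℂ := FourierTransform.fourier P
  have hone : ∀ ξ : Ed d, ‖ξ‖ ≤ 1 → (b ξ : ℂ) = 1 := fun ξ hξ => by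
    rw [b.one_of_mem_closedBall (by simpa [b] using hξ)]; simp
  have hG : ∀ y, SchwartzMap.compCLMOfContinuousLinearEquiv ℝ e F y =
      FourierTransform.fourier (fun ξ => (b ξ : ℂ)) ((2 * Real.pi)⁻¹ • y) := fun y => rfl
  refine ⟨fun ξ => (b ξ : ℂ), SchwartzMap.compCLMOfContinuousLinearEquiv ℝ e F, hs, hc, hone,
    fun y => by rw [hG, pFT_eq_fourier], ?_⟩
  simp only [hG]
  rw [Measure.integral_comp_smul]
  refine smul_ne_zero (by positivity) ?_
  have hinv : FourierTransformInv.fourierInv F 0 = P 0 := by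
    simp [F]
  have h0 : P 0 = 1 := hone 0 (by simp)
  rw [SchwartzMap.fourierInv_coe, Real.fourierInv_eq', h0] at hinv
  simp only [inner_zero_right, mul_zero, Complex.ofReal_zero, zero_mul, Complex.exp_zero,
    one_smul] at hinv
  exact fun h => one_ne_zero (hinv.symm.trans h)

lemma integrable_growth_mul_schwartz {d : ℕ} (G : SchwartzMap (Ed d) ℂ) (A : ℝ) (N : ℕ) :
    Integrable (fun w : Ed d => A * (1 + ‖w‖) ^ N * ‖G w‖) := by
  simp_rw [add_comm (1 : ℝ), add_pow, mul_assoc, Finset.sum_mul]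
  refine Integrable.const_mul (integrable_finsetSum _ fun k _ => ?_) A
  simpa [mul_assoc, mul_left_comm, mul_comm] using
    (G.integrable_pow_mul volume k).const_mul (N.choose k : ℝ)

lemma growth_dilate_le {d : ℕ} {A : ℝ} {N : ℕ} {a : ℝ} {u : Ed d → ℂ}
    (hu : ∀ y : Ed d, ‖u y‖ ≤ A * (1 + ‖y‖) ^ N) (ha : 0 ≤ a) (x w : Ed d) :
    ‖u (x + a • w)‖ ≤ A * ((1 + ‖x‖) * (1 + a)) ^ N * (1 + ‖w‖) ^ N := by
  have hA : 0 ≤ A := by simpa using (norm_nonneg _).trans (hu 0)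
  refine (hu _).trans ?_
  rw [mul_assoc, ← mul_pow]
  gcongr
  have := norm_add_le x (a • w)
  rw [norm_smul, Real.norm_of_nonneg ha] at this
  have h1 := norm_nonneg x
  have h2 := norm_nonneg w
  have : 0 ≤ ‖x‖ * a * ‖w‖ := by positivity
  have : 0 ≤ ‖x‖ * a := by positivity
  have : 0 ≤ ‖x‖ * ‖w‖ := by positivity
  nlinarith

lemma integrable_dilate_mul {d : ℕ} {A : ℝ} {N : ℕ} {a : ℝ} {u : Ed d → ℂ} (hc : Continuous u)
    (hu : ∀ y : Ed d, ‖u y‖ ≤ A * (1 + ‖y‖) ^ N) (ha : 0 ≤ a) (G : SchwartzMap (Ed d) ℂ)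
    (x : Ed d) : Integrable (fun w => u (x + a • w) * G w) := by
  refine (integrable_growth_mul_schwartz G (A * ((1 + ‖x‖) * (1 + a)) ^ N) N).mono'
    (by have := G.continuous; fun_prop) (ae_of_all _ fun w => ?_)
  rw [norm_mul]
  gcongr
  exact growth_dilate_le hu ha x w

/-- Functions whose Fourier transform lives in the ball of radius `t` are reproduced by averaging
against a fixed Schwartz kernel dilated to scale `t⁻¹`. -/
lemma exists_reproducing_kernel (d : ℕ) : ∃ G : SchwartzMap (Ed d) ℂ, ∫ y, G y ≠ 0 ∧
    ∀ (t : ℝ), 0 < t → ∀ (u : Ed d → ℂ), Continuous u →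
      ∀ (A₀ : ℝ) (N₀ : ℕ), (∀ y : Ed d, ‖u y‖ ≤ A₀ * (1 + ‖y‖) ^ N₀) →
      (∀ φ : SchwartzMap (Ed d) ℂ, (∀ ξ : Ed d, ‖ξ‖ < t → φ ξ = 0) →
        (∫ x : Ed d, u x * pFT (⇑φ) x) = 0) →
      ∀ x, u x * ∫ w, G w = ∫ w, u (x + t⁻¹ • w) * G w := by
  obtain ⟨ψ, G, hs, hc, hone, hG, hG0⟩ := exists_cutoff d
  refine ⟨G, hG0, fun t ht u hu A N hA hφ x => ?_⟩
  have hsc : ∀ a : ℝ, 0 < a → ∃ φ : SchwartzMap (Ed d) ℂ, ∀ ξ,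
      φ ξ = Complex.exp (Complex.I * ((⟪ξ, x⟫ : ℝ) : ℂ)) * ψ (a • ξ) := fun a ha => by
    have h1 : HasCompactSupport (fun ξ => Complex.exp (Complex.I * ((⟪ξ, x⟫ : ℝ) : ℂ)) *
        ψ (a • ξ)) := (hc.comp_smul ha.ne').mul_left
    have h2 : ContDiff ℝ (⊤ : ℕ∞) (fun ξ => Complex.exp (Complex.I * ((⟪ξ, x⟫ : ℝ) : ℂ)) *
        ψ (a • ξ)) := by
      refine ContDiff.mul (ContDiff.cexp (contDiff_const.mul ?_)) (hs.comp (by fun_prop))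
      exact Complex.ofRealCLM.contDiff.comp (contDiff_id.inner ℝ contDiff_const)
    exact ⟨h1.toSchwartzMap h2, fun ξ => rfl⟩
  have hpFT : ∀ a : ℝ, 0 < a → ∀ φ : SchwartzMap (Ed d) ℂ,
      (∀ ξ, φ ξ = Complex.exp (Complex.I * ((⟪ξ, x⟫ : ℝ) : ℂ)) * ψ (a • ξ)) → ∀ y,
      pFT φ y = ((a ^ d)⁻¹ : ℝ) • G (a⁻¹ • (y - x)) := fun a ha φ h y => by
    rw [hG, ← pFT_modulate ψ x y ha, funext h]
  have hintegral : ∀ a : ℝ, 0 < a →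
      Integrable (fun y => u y * (((a ^ d)⁻¹ : ℝ) • G (a⁻¹ • (y - x)))) := fun a ha => by
    have h := (integrable_dilate_mul hu hA ha.le G x).comp_smul (inv_ne_zero ha.ne')
    have h := (h.comp_sub_right x).const_mul (((a ^ d)⁻¹ : ℝ) : ℂ)
    refine h.congr (ae_of_all _ fun y => ?_)
    simp only [smul_inv_smul₀ ha.ne', add_sub_cancel, Complex.real_smul]
    ring
  have hexpint : ∀ (φ : SchwartzMap (Ed d) ℂ) (y : Ed d), Integrable
      (fun ξ : Ed d => Complex.exp (-(Complex.I) * ((⟪ξ, y⟫ : ℝ) : ℂ)) * φ ξ) := fun φ y => by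
    refine φ.integrable.norm.mono' (by have := φ.continuous; fun_prop) (ae_of_all _ fun ξ => ?_)
    rw [norm_mul, mul_comm (-Complex.I), mul_neg, ← neg_mul, ← Complex.ofReal_neg,
      Complex.norm_exp_ofReal_mul_I, one_mul]
  have hconst : ∀ a : ℝ, 0 < a → a ≤ t⁻¹ →
      ∫ w, u (x + a • w) * G w = ∫ w, u (x + t⁻¹ • w) * G w := fun a ha hat => by
    have ht' : 0 < t⁻¹ := inv_pos.2 ht
    obtain ⟨φ₁, h₁⟩ := hsc a ha
    obtain ⟨φ₂, h₂⟩ := hsc t⁻¹ ht'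
    have key := hφ (φ₁ - φ₂) fun ξ hξ => by
      have : t⁻¹ * ‖ξ‖ ≤ 1 := by
        rw [inv_mul_le_iff₀ ht]; linarith
      rw [sub_apply, h₁, h₂, hone, hone, sub_self]
      · rwa [norm_smul, Real.norm_of_nonneg ht'.le]
      · rw [norm_smul, Real.norm_of_nonneg ha.le]
        exact le_trans (by gcongr) this
    have hsub : ∀ y, pFT (⇑(φ₁ - φ₂)) y = pFT φ₁ y - pFT φ₂ y := fun y => by
      simp only [pFT, sub_apply, mul_sub]
      exact integral_sub (hexpint φ₁ y) (hexpint φ₂ y)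
    simp only [hsub, hpFT a ha φ₁ h₁, hpFT _ ht' φ₂ h₂, mul_sub] at key
    rw [integral_sub (hintegral a ha) (hintegral _ ht'), integral_mul_dilate u G x ha,
      integral_mul_dilate u G x ht'] at key
    exact sub_eq_zero.1 key
  have hlim : Filter.Tendsto (fun a : ℝ => ∫ w, u (x + a • w) * G w)
      (nhdsWithin 0 (Set.Ioi 0)) (nhds (∫ w, u x * G w)) := by
    refine tendsto_integral_filter_of_dominated_convergence _
      (Filter.Eventually.of_forall fun a => by have := G.continuous; fun_prop) ?_
      (integrable_growth_mul_schwartz G (A * ((1 + ‖x‖) * (1 + 1)) ^ N) N) ?_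
    · filter_upwards [Ioo_mem_nhdsGT (zero_lt_one (α := ℝ))] with a ha
      refine ae_of_all _ fun w => ?_
      have hA0 : 0 ≤ A := by simpa using (norm_nonneg _).trans (hA 0)
      rw [norm_mul]
      gcongr
      refine (growth_dilate_le hA ha.1.le x w).trans ?_
      have := ha.1
      gcongr
      exact ha.2.le
    · refine ae_of_all _ fun w => Filter.Tendsto.mul_const _ ?_
      have : Continuous fun a : ℝ => u (x + a • w) := by fun_prop
      simpa using (this.tendsto 0).mono_left nhdsWithin_le_nhds
  have hlim' : Filter.Tendsto (fun a : ℝ => ∫ w, u (x + a • w) * G w)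
      (nhdsWithin 0 (Set.Ioi 0)) (nhds (∫ w, u (x + t⁻¹ • w) * G w)) := by
    refine tendsto_const_nhds.congr' ?_
    filter_upwards [Ioc_mem_nhdsGT (inv_pos.2 ht)] with a ha
    exact (hconst a ha.1 ha.2).symm
  rw [← tendsto_nhds_unique hlim hlim', integral_const_mul]

/-- The weight `1 + ‖w‖`, valued in `ℝ≥0∞`. -/
noncomputable def polyWeight {d : ℕ} (w : Ed d) : ℝ≥0∞ := 1 + ‖w‖ₑ

/-- The average of `g` around `y` against the weight `(1 + ‖w‖) ^ (-K)`. -/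
noncomputable def polyAvg {d : ℕ} (K : ℕ) (g : Ed d → ℝ≥0∞) (y : Ed d) : ℝ≥0∞ :=
  ∫⁻ w, g (y + w) * (polyWeight w ^ K)⁻¹

/-- The centered maximal function of a function valued in `ℝ≥0∞`. -/
noncomputable def ballSup {d : ℕ} (g : Ed d → ℝ≥0∞) (x : Ed d) : ℝ≥0∞ :=
  ⨆ (ρ : ℝ) (_ : 0 < ρ), (∫⁻ y in Metric.ball x ρ, g y) / volume (Metric.ball x ρ)

section Weight

variable {d : ℕ}

lemma one_le_polyWeight (w : Ed d) : 1 ≤ polyWeight w := le_self_add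

lemma polyWeight_ne_zero (w : Ed d) : polyWeight w ≠ 0 :=
  (zero_lt_one.trans_le (one_le_polyWeight w)).ne'

lemma polyWeight_ne_top (w : Ed d) : polyWeight w ≠ ∞ := by simp [polyWeight]

lemma polyWeight_eq_ofReal (w : Ed d) : polyWeight w = ENNReal.ofReal (1 + ‖w‖) := by
  rw [polyWeight, ENNReal.ofReal_add zero_le_one (norm_nonneg w), ofReal_norm, ENNReal.ofReal_one]

lemma polyWeight_neg (w : Ed d) : polyWeight (-w) = polyWeight w := by simp [polyWeight]

lemma polyWeight_add_le (v w : Ed d) : polyWeight (v + w) ≤ polyWeight v * polyWeight w := by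
  simp only [polyWeight]
  calc 1 + ‖v + w‖ₑ ≤ 1 + (‖v‖ₑ + ‖w‖ₑ) := by gcongr; exact enorm_add_le v w
    _ ≤ 1 + (‖v‖ₑ + ‖w‖ₑ) + ‖v‖ₑ * ‖w‖ₑ := le_self_add
    _ = _ := by ring

lemma polyWeight_sub_le (v w : Ed d) : polyWeight (v - w) ≤ polyWeight v * polyWeight w := by
  rw [sub_eq_add_neg, ← polyWeight_neg w]
  exact polyWeight_add_le v (-w)

@[fun_prop]
lemma measurable_polyWeight : Measurable (polyWeight : Ed d → ℝ≥0∞) := by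
  unfold polyWeight; fun_prop

end Weight

lemma polyAvg_anti {d : ℕ} {K L : ℕ} (h : K ≤ L) (g : Ed d → ℝ≥0∞) (y : Ed d) :
    polyAvg L g y ≤ polyAvg K g y := by
  unfold polyAvg
  gcongr
  exact one_le_polyWeight _

lemma inv_polyWeight_pow_le_tsum {d : ℕ} (K : ℕ) (w : Ed d) :
    (polyWeight w ^ K)⁻¹ ≤ ∑' n : ℕ, (((2 : ℝ≥0∞) ^ n) ^ K)⁻¹ *
      (Metric.ball (0 : Ed d) (2 ^ (n + 1))).indicator 1 w := by
  obtain ⟨n, h1, h2⟩ := exists_nat_pow_near (x := 1 + ‖w‖) (y := 2) (by simp) (by norm_num)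
  refine le_trans ?_ (ENNReal.le_tsum n)
  have : w ∈ Metric.ball (0 : Ed d) (2 ^ (n + 1)) := by
    rw [mem_ball_zero_iff]; linarith
  rw [Set.indicator_of_mem this, Pi.one_apply, mul_one]
  gcongr
  calc (2 : ℝ≥0∞) ^ n = ENNReal.ofReal (2 ^ n) := by
        rw [ENNReal.ofReal_pow zero_le_two, ENNReal.ofReal_ofNat]
    _ ≤ _ := by rw [polyWeight_eq_ofReal]; exact ENNReal.ofReal_le_ofReal h1

lemma lintegral_ball_le_ballSup {d : ℕ} (g : Ed d → ℝ≥0∞) (x : Ed d) {ρ : ℝ} (hρ : 0 < ρ) :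
    ∫⁻ y in Metric.ball x ρ, g y ≤ ballSup g x * volume (Metric.ball x ρ) := by
  rw [← ENNReal.div_le_iff (Metric.measure_ball_pos volume x hρ).ne' measure_ball_lt_top.ne]
  exact le_iSup₂_of_le ρ hρ le_rfl

lemma lintegral_shifted_ball_le {d : ℕ} (g : Ed d → ℝ≥0∞) (x z : Ed d) {R : ℝ} (hR : 1 ≤ R) :
    ∫⁻ w, g (x - z + w) * (Metric.ball (0 : Ed d) R).indicator 1 w ≤
      ENNReal.ofReal R ^ d * polyWeight z ^ d * volume (Metric.ball (0 : Ed d) 1) *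
        ballSup g x := by
  have hpos : 0 < R * (1 + ‖z‖) := by positivity
  calc ∫⁻ w, g (x - z + w) * (Metric.ball (0 : Ed d) R).indicator 1 w
      ≤ ∫⁻ w, (Metric.ball x (R * (1 + ‖z‖))).indicator g (x - z + w) := by
        refine lintegral_mono fun w => ?_
        by_cases hw : w ∈ Metric.ball (0 : Ed d) R
        · have : x - z + w ∈ Metric.ball x (R * (1 + ‖z‖)) := by
            rw [mem_ball_iff_norm]
            rw [mem_ball_zero_iff] at hw
            have h1 : ‖x - z + w - x‖ ≤ ‖w‖ + ‖z‖ := by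
              rw [show x - z + w - x = w - z by abel]; exact norm_sub_le w z
            nlinarith [norm_nonneg z]
          simp [hw, this]
        · simp [hw]
    _ = ∫⁻ v in Metric.ball x (R * (1 + ‖z‖)), g v := by
        rw [lintegral_add_left_eq_self, lintegral_indicator Metric.isOpen_ball.measurableSet]
    _ ≤ _ := lintegral_ball_le_ballSup g x hpos
    _ = _ := by
        rw [Measure.addHaar_ball_of_pos volume x hpos, finrank_euclideanSpace_fin,
          ENNReal.ofReal_pow hpos.le, ENNReal.ofReal_mul (by positivity), polyWeight_eq_ofReal,
          mul_pow]
        ring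

/-- The constant controlling averages against `(1 + ‖w‖) ^ (-(d + 1))` by the maximal function. -/
noncomputable def avgConst (d : ℕ) : ℝ≥0∞ := 2 * 2 ^ d * volume (Metric.ball (0 : Ed d) 1)

lemma avgConst_ne_top (d : ℕ) : avgConst d ≠ ∞ :=
  ENNReal.mul_ne_top (by finiteness) measure_ball_lt_top.ne

lemma polyAvg_le_ballSup {d : ℕ} {g : Ed d → ℝ≥0∞} (hg : Measurable g) (x z : Ed d) :
    polyAvg (d + 1) g (x - z) ≤ avgConst d * polyWeight z ^ d * ballSup g x := by
  have h2 : ∀ n : ℕ, (2 : ℝ≥0∞) ^ n ≠ 0 := fun n => by positivity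
  have h2' : ∀ n : ℕ, (2 : ℝ≥0∞) ^ n ≠ ∞ := fun n => by finiteness
  calc polyAvg (d + 1) g (x - z)
      ≤ ∫⁻ w, ∑' n : ℕ, (((2 : ℝ≥0∞) ^ n) ^ (d + 1))⁻¹ * (g (x - z + w) *
          (Metric.ball (0 : Ed d) (2 ^ (n + 1))).indicator 1 w) := by
        refine lintegral_mono fun w => ?_
        refine (mul_le_mul_right (inv_polyWeight_pow_le_tsum (d + 1) w) _).trans_eq ?_
        rw [← ENNReal.tsum_mul_left]
        congr 1 with n
        ring
    _ = ∑' n : ℕ, (((2 : ℝ≥0∞) ^ n) ^ (d + 1))⁻¹ * ∫⁻ w, (g (x - z + w) *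
          (Metric.ball (0 : Ed d) (2 ^ (n + 1))).indicator 1 w) := by
        have hm : ∀ n : ℕ, Measurable fun w => g (x - z + w) *
            (Metric.ball (0 : Ed d) (2 ^ (n + 1))).indicator 1 w := fun n =>
          (hg.comp (measurable_const_add _)).mul
            (measurable_one.indicator Metric.isOpen_ball.measurableSet)
        rw [lintegral_tsum fun n => ((hm n).const_mul _).aemeasurable]
        congr 1 with n
        rw [lintegral_const_mul _ (hm n)]
    _ ≤ ∑' n : ℕ, ((2 : ℝ≥0∞) ^ n)⁻¹ * (2 ^ d * volume (Metric.ball (0 : Ed d) 1) *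
          polyWeight z ^ d * ballSup g x) := by
        refine ENNReal.tsum_le_tsum fun n => ?_
        refine (mul_le_mul_right (lintegral_shifted_ball_le g x z
          (one_le_pow₀ one_le_two)) _).trans_eq ?_
        rw [ENNReal.ofReal_pow zero_le_two, ENNReal.ofReal_ofNat, pow_succ 2 n, mul_pow,
          pow_succ _ d, ENNReal.mul_inv (.inl (pow_ne_zero _ (h2 n))) (.inr (h2 n))]
        have := ENNReal.inv_mul_cancel (pow_ne_zero d (h2 n)) (ENNReal.pow_ne_top (h2' n) (n := d))
        calc _ = ((((2 : ℝ≥0∞) ^ n) ^ d)⁻¹ * (2 ^ n) ^ d) * (((2 : ℝ≥0∞) ^ n)⁻¹ *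
              (2 ^ d * volume (Metric.ball (0 : Ed d) 1) * polyWeight z ^ d * ballSup g x)) := by
              ring
          _ = _ := by rw [this, one_mul]
    _ = _ := by
        rw [ENNReal.tsum_mul_right]
        simp_rw [ENNReal.inv_pow]
        rw [ENNReal.tsum_geometric_two, avgConst]
        ring

lemma ENNReal.rpow_le_of_le_rpow_one_sub_mul {r : ℝ} (hr : 0 < r) {S B : ℝ≥0∞} (hS : S ≠ ∞)
    (h : S ≤ S ^ (1 - r) * B) : S ^ r ≤ B := by
  rcases eq_or_ne S 0 with rfl | h0
  · simp [hr]
  · have h1 : S ^ (1 - r) ≠ 0 := by simp [h0, hS]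
    have h2 : S ^ (1 - r) ≠ ∞ := ENNReal.rpow_ne_top_of_ne_zero h0 hS
    rw [← ENNReal.mul_le_mul_iff_right h1 h2, ← ENNReal.rpow_add _ _ h0 hS]
    simpa using h

lemma le_polyAvg_rpow {d : ℕ} {r : ℝ} (hr : 0 < r) (hr1 : r ≤ 1) {f : Ed d → ℝ≥0∞} {N : ℝ}
    (hN : 0 ≤ N) (K : ℕ) {c S : ℝ≥0∞} {x : Ed d} (hf : Measurable f)
    (hc : ∀ y, f y ≤ c * polyAvg (K + ⌈N⌉₊) f y)
    (hS : ∀ z, f (x - z) ≤ S * polyWeight z ^ N) (z : Ed d) :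
    f (x - z) ≤ c * (S ^ (1 - r) * polyWeight z ^ (N * (1 - r)) *
      polyAvg K (fun y => f y ^ r) (x - z)) := by
  have hr' : 0 ≤ 1 - r := by linarith
  refine (hc _).trans (mul_le_mul_right ?_ _)
  unfold polyAvg
  rw [← lintegral_const_mul _ (by fun_prop)]
  refine lintegral_mono fun w => ?_
  set p := polyWeight w
  have hp : p ^ (N * (1 - r)) ≤ p ^ ⌈N⌉₊ := by
    rw [← ENNReal.rpow_natCast]
    refine ENNReal.rpow_le_rpow_of_exponent_le (one_le_polyWeight w) ?_
    refine le_trans ?_ (Nat.le_ceil N)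
    exact mul_le_of_le_one_right hN (by linarith)
  have hfac : f (x - z + w) ^ (1 - r) ≤
      S ^ (1 - r) * polyWeight z ^ (N * (1 - r)) * p ^ ⌈N⌉₊ := by
    calc f (x - z + w) ^ (1 - r) = f (x - (z - w)) ^ (1 - r) := by congr 2; abel
      _ ≤ (S * (polyWeight z * p) ^ N) ^ (1 - r) := by
          refine ENNReal.rpow_le_rpow ((hS _).trans ?_) hr'
          gcongr
          exact polyWeight_sub_le z w
      _ = S ^ (1 - r) * polyWeight z ^ (N * (1 - r)) * p ^ (N * (1 - r)) := by
          rw [ENNReal.mul_rpow_of_nonneg _ _ hr', ← ENNReal.rpow_mul,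
            ENNReal.mul_rpow_of_nonneg _ _ (by positivity), mul_assoc]
      _ ≤ _ := by gcongr
  have hcancel : p ^ ⌈N⌉₊ * (p ^ ⌈N⌉₊)⁻¹ = 1 :=
    ENNReal.mul_inv_cancel (pow_ne_zero _ (polyWeight_ne_zero w))
      (ENNReal.pow_ne_top (polyWeight_ne_top w))
  calc f (x - z + w) * (p ^ (K + ⌈N⌉₊))⁻¹
      = f (x - z + w) ^ r * f (x - z + w) ^ (1 - r) * ((p ^ K)⁻¹ * (p ^ ⌈N⌉₊)⁻¹) := by
        rw [← ENNReal.rpow_add_of_nonneg _ _ hr.le hr', add_sub_cancel, ENNReal.rpow_one, pow_add,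
          ENNReal.mul_inv (.inl (pow_ne_zero _ (polyWeight_ne_zero w)))
            (.inr (pow_ne_zero _ (polyWeight_ne_zero w)))]
    _ ≤ f (x - z + w) ^ r * (S ^ (1 - r) * polyWeight z ^ (N * (1 - r)) * p ^ ⌈N⌉₊) *
          ((p ^ K)⁻¹ * (p ^ ⌈N⌉₊)⁻¹) := by gcongr
    _ = S ^ (1 - r) * polyWeight z ^ (N * (1 - r)) * (f (x - z + w) ^ r * (p ^ K)⁻¹) *
          (p ^ ⌈N⌉₊ * (p ^ ⌈N⌉₊)⁻¹) := by ring
    _ = _ := by rw [hcancel, mul_one]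

/-- A finite weighted supremum which is dominated by a power of itself is dominated outright. -/
lemma rpow_le_of_polyAvg_le {d : ℕ} {r : ℝ} (hr : 0 < r) (hr1 : r ≤ 1) {f : Ed d → ℝ≥0∞} {N : ℝ}
    (hN : 0 ≤ N) (K : ℕ) {c A B : ℝ≥0∞} {x : Ed d} (hf : Measurable f)
    (hc : ∀ y, f y ≤ c * polyAvg (K + ⌈N⌉₊) f y) (hA : A ≠ ∞)
    (hfA : ∀ z, f (x - z) ≤ A * polyWeight z ^ N)
    (hB : ∀ z, c * polyAvg K (fun y => f y ^ r) (x - z) ≤ B * polyWeight z ^ (N * r)) (z : Ed d) :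
    f (x - z) ^ r ≤ B * polyWeight z ^ (N * r) := by
  have h0 : ∀ (z : Ed d) (a : ℝ), polyWeight z ^ a ≠ 0 := fun z a => by
    simp [ENNReal.rpow_eq_zero_iff, polyWeight_ne_zero, polyWeight_ne_top]
  have htop : ∀ (z : Ed d) (a : ℝ), polyWeight z ^ a ≠ ∞ := fun z a =>
    ENNReal.rpow_ne_top_of_ne_zero (polyWeight_ne_zero z) (polyWeight_ne_top z)
  set S := ⨆ z, f (x - z) / polyWeight z ^ N with hSdef
  have hSA : S ≤ A := iSup_le fun z => ENNReal.div_le_of_le_mul (hfA z)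
  have hfS : ∀ z, f (x - z) ≤ S * polyWeight z ^ N := fun z => by
    rw [← ENNReal.div_le_iff (h0 z N) (htop z N)]
    exact le_iSup (fun z => f (x - z) / polyWeight z ^ N) z
  have hS : S ≤ S ^ (1 - r) * B := iSup_le fun z => by
    rw [ENNReal.div_le_iff (h0 z N) (htop z N)]
    calc f (x - z) ≤ S ^ (1 - r) * polyWeight z ^ (N * (1 - r)) *
          (c * polyAvg K (fun y => f y ^ r) (x - z)) :=
          (le_polyAvg_rpow hr hr1 hN K hf hc hfS z).trans_eq (by ring)
      _ ≤ S ^ (1 - r) * polyWeight z ^ (N * (1 - r)) * (B * polyWeight z ^ (N * r)) := by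
          exact mul_le_mul_right (hB z) _
      _ = S ^ (1 - r) * B * (polyWeight z ^ (N * (1 - r)) * polyWeight z ^ (N * r)) := by ring
      _ = _ := by
          rw [← ENNReal.rpow_add _ _ (polyWeight_ne_zero z) (polyWeight_ne_top z)]
          congr 2; ring
  have hSr := ENNReal.rpow_le_of_le_rpow_one_sub_mul hr (ne_top_of_le_ne_top hA hSA) hS
  calc f (x - z) ^ r ≤ (S * polyWeight z ^ N) ^ r := ENNReal.rpow_le_rpow (hfS z) hr.le
    _ = S ^ r * polyWeight z ^ (N * r) := by
        rw [ENNReal.mul_rpow_of_nonneg _ _ hr.le, ← ENNReal.rpow_mul]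
    _ ≤ _ := by gcongr

lemma polyAvg_sub_le {d : ℕ} (K : ℕ) (g : Ed d → ℝ≥0∞) (x z : Ed d) :
    polyAvg K g (x - z) ≤ polyAvg K g x * polyWeight z ^ K := by
  unfold polyAvg
  rw [← lintegral_mul_const' _ _ (ENNReal.pow_ne_top (polyWeight_ne_top z)),
    ← lintegral_add_left_eq_self _ z]
  refine lintegral_mono fun w => ?_
  have h0 := pow_ne_zero K (polyWeight_ne_zero w)
  have htop := ENNReal.pow_ne_top (polyWeight_ne_top w) (n := K)
  have h0' := pow_ne_zero K (polyWeight_ne_zero (z + w))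
  have htop' := ENNReal.pow_ne_top (polyWeight_ne_top (z + w)) (n := K)
  have hle : polyWeight w ^ K ≤ polyWeight (z + w) ^ K * polyWeight z ^ K := by
    rw [← mul_pow]
    gcongr
    simpa using polyWeight_sub_le (z + w) z
  rw [← add_assoc, sub_add_cancel, mul_assoc]
  gcongr
  rw [← ENNReal.div_eq_inv_mul, ENNReal.le_div_iff_mul_le (.inl h0) (.inl htop),
    mul_comm, ← div_eq_mul_inv, ENNReal.div_le_iff h0' htop', mul_comm]
  exact hle

/-- Any polynomial growth rate of `f` self-improves to the rate `d / r`. -/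
lemma rpow_le_ballSup_of_le_one {d : ℕ} {r : ℝ} (hr : 0 < r) (hr1 : r ≤ 1) {f : Ed d → ℝ≥0∞}
    (hf : Measurable f) {c : ℕ → ℝ≥0∞} (hctop : ∀ K, c K ≠ ∞)
    (hc : ∀ K y, f y ≤ c K * polyAvg K f y) {A : ℝ≥0∞} (hA : A ≠ ∞) {N₀ : ℕ}
    (hfA : ∀ y, f y ≤ A * polyWeight y ^ N₀) (x : Ed d)
    (hx : ballSup (fun y => f y ^ r) x ≠ ∞) (z : Ed d) :
    f (x - z) ^ r ≤ c (d + 1 + ⌈(d : ℝ) / r⌉₊) * avgConst d * polyWeight z ^ d *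
      ballSup (fun y => f y ^ r) x := by
  have hfr : Measurable (fun y => f y ^ r) := hf.pow_const r
  have hdr : (d : ℝ) / r * r = d := div_mul_cancel₀ _ hr.ne'
  -- a first pass at a large growth rate bounds `f ^ r` pointwise by its averages
  obtain ⟨K, hKd, hKN⟩ : ∃ K : ℕ, d + 1 ≤ K ∧ (N₀ : ℝ) ≤ K / r :=
    ⟨max (d + 1) N₀, le_max_left _ _, by
      rw [le_div_iff₀ hr]
      refine (mul_le_of_le_one_right (Nat.cast_nonneg _) hr1).trans ?_
      exact_mod_cast le_max_right _ _⟩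
  have hKr : (K : ℝ) / r * r = K := div_mul_cancel₀ _ hr.ne'
  set c₁ := c (K + ⌈(K : ℝ) / r⌉₊)
  have hpt : ∀ y, f y ^ r ≤ c₁ * polyAvg K (fun y => f y ^ r) y := fun y => by
    have := rpow_le_of_polyAvg_le hr hr1 (N := K / r) (by positivity) K (x := y)
      (A := A * polyWeight y ^ N₀) (B := c₁ * polyAvg K (fun y => f y ^ r) y) hf (hc _)
      (ENNReal.mul_ne_top hA (ENNReal.pow_ne_top (polyWeight_ne_top y)))
      (fun z => ?_) (fun z => ?_) 0
    · simpa [polyWeight] using this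
    · calc f (y - z) ≤ A * (polyWeight y * polyWeight z) ^ N₀ := by
            refine (hfA _).trans ?_
            gcongr
            exact polyWeight_sub_le y z
        _ = A * polyWeight y ^ N₀ * polyWeight z ^ (N₀ : ℝ) := by
            rw [mul_pow, ENNReal.rpow_natCast, mul_assoc]
        _ ≤ _ := by
            gcongr
            exact one_le_polyWeight z
    · rw [hKr, ENNReal.rpow_natCast, mul_assoc]
      gcongr
      exact polyAvg_sub_le K _ y z
  have hI : ∀ z, polyAvg (d + 1) (fun y => f y ^ r) (x - z) ≤
      avgConst d * polyWeight z ^ d * ballSup (fun y => f y ^ r) x := polyAvg_le_ballSup hfr x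
  set Q := ballSup (fun y => f y ^ r) x
  have := rpow_le_of_polyAvg_le hr hr1 (N := d / r) (by positivity) (d + 1) (x := x)
    (A := (c₁ * avgConst d * Q) ^ (1 / r)) (B := c (d + 1 + ⌈(d : ℝ) / r⌉₊) * avgConst d * Q)
    hf (hc _) ?_ (fun z => ?_) (fun z => ?_) z
  · rw [hdr, ENNReal.rpow_natCast] at this
    exact this.trans_eq (by ring)
  · refine ENNReal.rpow_ne_top_of_nonneg (by positivity) ?_
    exact ENNReal.mul_ne_top (ENNReal.mul_ne_top (hctop _) (avgConst_ne_top d)) hx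
  · rw [← ENNReal.rpow_le_rpow_iff hr, ENNReal.mul_rpow_of_nonneg _ _ hr.le, ← ENNReal.rpow_mul,
      ← ENNReal.rpow_mul, hdr, one_div_mul_cancel hr.ne', ENNReal.rpow_one, ENNReal.rpow_natCast]
    calc f (x - z) ^ r ≤ c₁ * polyAvg (d + 1) (fun y => f y ^ r) (x - z) := by
          refine (hpt _).trans ?_
          gcongr
          exact polyAvg_anti hKd _ _
      _ ≤ c₁ * (avgConst d * polyWeight z ^ d * Q) := by gcongr; exact hI z
      _ = _ := by ring
  · rw [hdr, ENNReal.rpow_natCast]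
    calc _ ≤ c (d + 1 + ⌈(d : ℝ) / r⌉₊) * (avgConst d * polyWeight z ^ d * Q) := by
          gcongr; exact hI z
      _ = _ := by ring

lemma polyAvg_rpow_le {d : ℕ} {r : ℝ} (hr : 1 ≤ r) {f : Ed d → ℝ≥0∞} (hf : Measurable f)
    (y : Ed d) : polyAvg (d + 1) f y ^ r ≤
      avgConst d ^ (r - 1) * polyAvg (d + 1) (fun y => f y ^ r) y := by
  have hr0 : 0 < r := by linarith
  set μ : Measure (Ed d) := volume.withDensity fun w => (polyWeight w ^ (d + 1))⁻¹ with hμ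
  have hμI : ∀ g : Ed d → ℝ≥0∞, Measurable g → ∫⁻ w, g (y + w) ∂μ = polyAvg (d + 1) g y :=
    fun g hg => by
      rw [hμ, lintegral_withDensity_eq_lintegral_mul _ (by fun_prop) (by fun_prop), polyAvg]
      simp only [Pi.mul_apply, mul_comm]
  have hmass : μ Set.univ ≤ avgConst d := by
    have h1 := hμI (fun _ => 1) measurable_const
    rw [lintegral_one] at h1
    have h2 := polyAvg_le_ballSup (measurable_const (a := (1 : ℝ≥0∞))) y 0
    have h3 : ballSup (fun _ => (1 : ℝ≥0∞)) y ≤ 1 := iSup₂_le fun ρ hρ => by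
      simp [ENNReal.div_self_le_one]
    rw [sub_zero] at h2
    rw [h1]
    refine h2.trans ((mul_le_mul_right h3 _).trans_eq ?_)
    simp [polyWeight]
  have hH := eLpNorm'_le_eLpNorm'_mul_rpow_measure_univ (μ := μ) (f := fun w => f (y + w))
    zero_lt_one hr (hf.comp (measurable_const_add y)).aestronglyMeasurable
  simp only [eLpNorm', enorm_eq_self, ENNReal.rpow_one, div_one, hμI f hf] at hH
  rw [hμI (fun y => f y ^ r) (hf.pow_const r)] at hH
  calc polyAvg (d + 1) f y ^ r ≤ _ := ENNReal.rpow_le_rpow hH hr0.le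
    _ = μ Set.univ ^ (r - 1) * polyAvg (d + 1) (fun y => f y ^ r) y := by
        rw [ENNReal.mul_rpow_of_nonneg _ _ hr0.le, ← ENNReal.rpow_mul, ← ENNReal.rpow_mul,
          one_div_mul_cancel hr0.ne', ENNReal.rpow_one, mul_comm]
        congr 2
        field_simp
    _ ≤ _ := by gcongr

lemma exists_const_rpow_le_ballSup (d : ℕ) {r : ℝ} (hr : 0 < r) {c : ℕ → ℝ≥0∞}
    (hctop : ∀ K, c K ≠ ∞) : ∃ E : ℝ≥0∞, E ≠ ∞ ∧ ∀ f : Ed d → ℝ≥0∞, Measurable f →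
      (∀ K y, f y ≤ c K * polyAvg K f y) → ∀ (A : ℝ≥0∞) (N₀ : ℕ), A ≠ ∞ →
      (∀ y, f y ≤ A * polyWeight y ^ N₀) → ∀ x z, ballSup (fun y => f y ^ r) x ≠ ∞ →
      f (x - z) ^ r ≤ E * polyWeight z ^ d * ballSup (fun y => f y ^ r) x := by
  rcases le_total r 1 with hr1 | hr1
  · exact ⟨_, ENNReal.mul_ne_top (hctop _) (avgConst_ne_top d), fun f hf hc A N₀ hA hfA x z hx =>
      rpow_le_ballSup_of_le_one hr hr1 hf hctop hc hA hfA x hx z⟩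
  · refine ⟨c (d + 1) ^ r * avgConst d ^ (r - 1) * avgConst d, ?_, ?_⟩
    · exact ENNReal.mul_ne_top (ENNReal.mul_ne_top
        (ENNReal.rpow_ne_top_of_nonneg hr.le (hctop _))
        (ENNReal.rpow_ne_top_of_nonneg (by linarith) (avgConst_ne_top d))) (avgConst_ne_top d)
    · intro f hf hc _ _ _ _ x z _
      calc f (x - z) ^ r ≤ (c (d + 1) * polyAvg (d + 1) f (x - z)) ^ r :=
            ENNReal.rpow_le_rpow (hc _ _) hr.le
        _ ≤ c (d + 1) ^ r * (avgConst d ^ (r - 1) *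
              (avgConst d * polyWeight z ^ d * ballSup (fun y => f y ^ r) x)) := by
            rw [ENNReal.mul_rpow_of_nonneg _ _ hr.le]
            gcongr
            refine (polyAvg_rpow_le hr1 hf _).trans ?_
            gcongr
            exact polyAvg_le_ballSup (hf.pow_const r) x z
        _ = _ := by ring

lemma ballSup_dilate_le_maxFn {d : ℕ} (u : Ed d → ℂ) (r : ℝ) (hr : 0 < r) {t : ℝ} (ht : 0 < t)
    (x : Ed d) : ballSup (fun y => ‖u (t⁻¹ • y)‖ₑ ^ r) (t • x) ≤ maxFn (fun y => ‖u y‖ ^ r) x := by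
  refine iSup₂_le fun ρ hρ => ?_
  have hρ' : 0 < t⁻¹ * ρ := by positivity
  refine le_iSup₂_of_le (t⁻¹ * ρ) hρ' ?_
  have hmem : ∀ y : Ed d, t⁻¹ • y ∈ Metric.ball x (t⁻¹ * ρ) ↔ y ∈ Metric.ball (t • x) ρ := by
    intro y
    rw [mem_ball_iff_norm, mem_ball_iff_norm,
      show t⁻¹ • y - x = t⁻¹ • (y - t • x) by rw [smul_sub, inv_smul_smul₀ ht.ne'], norm_smul,
      Real.norm_of_nonneg (inv_pos.2 ht).le]
    exact mul_lt_mul_iff_right₀ (inv_pos.2 ht)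
  have hintegral : ∀ g : Ed d → ℝ≥0∞, ∫⁻ y in Metric.ball (t • x) ρ, g (t⁻¹ • y) =
      ENNReal.ofReal (t ^ d) * ∫⁻ y in Metric.ball x (t⁻¹ * ρ), g y := by
    intro g
    have hemb : MeasurableEmbedding (fun y : Ed d => t⁻¹ • y) :=
      (Homeomorph.smulOfNeZero t⁻¹ (inv_ne_zero ht.ne')).measurableEmbedding
    have hmap := Measure.map_addHaar_smul (volume : Measure (Ed d)) (inv_ne_zero ht.ne')
    rw [finrank_euclideanSpace_fin, inv_pow, inv_inv, abs_of_nonneg (by positivity)] at hmap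
    rw [← lintegral_indicator Metric.isOpen_ball.measurableSet,
      ← lintegral_indicator Metric.isOpen_ball.measurableSet, ← smul_eq_mul,
      ← lintegral_smul_measure, ← hmap, hemb.lintegral_map]
    congr 1 with y
    by_cases hy : y ∈ Metric.ball (t • x) ρ
    · rw [Set.indicator_of_mem hy, Set.indicator_of_mem ((hmem y).2 hy)]
    · rw [Set.indicator_of_notMem hy, Set.indicator_of_notMem (mt (hmem y).1 hy)]
  have hvol : volume (Metric.ball (t • x) ρ) =
      ENNReal.ofReal (t ^ d) * volume (Metric.ball x (t⁻¹ * ρ)) := by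
    simpa using hintegral 1
  rw [hintegral fun y => ‖u y‖ₑ ^ r, hvol, ENNReal.mul_div_mul_left _ _ (by simp; positivity)
    ENNReal.ofReal_ne_top]
  gcongr with y
  rw [abs_of_nonneg (by positivity), ← ENNReal.ofReal_rpow_of_nonneg (norm_nonneg _) hr.le,
    ofReal_norm]

lemma SchwartzMap.enorm_le_inv_polyWeight_pow {d : ℕ} (G : SchwartzMap (Ed d) ℂ) (K : ℕ) :
    ∃ C : ℝ≥0∞, C ≠ ∞ ∧ ∀ w, ‖G w‖ₑ ≤ C * (polyWeight w ^ K)⁻¹ := by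
  obtain ⟨C, hC⟩ : ∃ C : ℝ, ∀ w, (1 + ‖w‖) ^ K * ‖G w‖ ≤ C :=
    ⟨_, fun w => by
      simpa using SchwartzMap.one_add_le_sup_seminorm_apply (𝕜 := ℝ) (m := (K, 0)) le_rfl le_rfl G w⟩
  refine ⟨ENNReal.ofReal C, ENNReal.ofReal_ne_top, fun w => ?_⟩
  rw [← div_eq_mul_inv, ENNReal.le_div_iff_mul_le
    (.inl (pow_ne_zero _ (polyWeight_ne_zero w)))
    (.inl (ENNReal.pow_ne_top (polyWeight_ne_top w))), polyWeight_eq_ofReal,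
    ← ENNReal.ofReal_pow (by positivity), ← ofReal_norm, mul_comm,
    ← ENNReal.ofReal_mul (by positivity)]
  exact ENNReal.ofReal_le_ofReal (hC w)

/-- Peetre–Fefferman–Stein maximal inequality for band-limited functions,
with no a priori growth assumption beyond the automatic polynomial growth.
If the distributional Fourier transform of `u` is supported in `{|ξ| < t}` — expressed by
testing against Schwartz functions vanishing on that ball — then for all `x`,
`sup_z |u(x-z)|/(1+t|z|)^{d/r} ≤ C(d,r) (𝓜(|u|^r)(x))^{1/r}`. -/
theorem stmt5 (d : ℕ) (hd : 1 ≤ d) (r : ℝ) (hr : 0 < r) :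
    ∃ C : ℝ≥0∞, C ≠ ∞ ∧
      ∀ (t : ℝ), 0 < t → ∀ (u : Ed d → ℂ), ContDiff ℝ (⊤ : ℕ∞) u →
      ∀ (A₀ : ℝ) (N₀ : ℕ), (∀ y : Ed d, ‖u y‖ ≤ A₀ * (1 + ‖y‖) ^ N₀) →
      (∀ φ : SchwartzMap (Ed d) ℂ, (∀ ξ : Ed d, ‖ξ‖ < t → φ ξ = 0) →
        Integrable (fun x => u x * pFT (⇑φ) x) ∧ (∫ x : Ed d, u x * pFT (⇑φ) x) = 0) →
      ∀ x z : Ed d,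
        (‖u (x - z)‖₊ : ℝ≥0∞) / ENNReal.ofReal ((1 + t * ‖z‖) ^ ((d : ℝ) / r)) ≤
          C * (maxFn (fun y => ‖u y‖ ^ r) x) ^ (1 / r) := by
  obtain ⟨G, hG0, hG⟩ := exists_reproducing_kernel d
  choose c hctop hc using fun K => G.enorm_le_inv_polyWeight_pow K
  have hG0' : ‖∫ y, G y‖ₑ ≠ 0 := by simpa using hG0
  obtain ⟨E, hE, hmain⟩ := exists_const_rpow_le_ballSup d hr
    (c := fun K => c K / ‖∫ y, G y‖ₑ) fun K => ENNReal.div_ne_top (hctop K) hG0'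
  have hr' : 0 ≤ 1 / r := by positivity
  refine ⟨(E + 1) ^ (1 / r), ENNReal.rpow_ne_top_of_nonneg hr' (by finiteness), ?_⟩
  intro t ht u hu A N hA hφ x z
  rw [← ENNReal.mul_rpow_of_nonneg _ _ hr']
  by_cases hM : maxFn (fun y => ‖u y‖ ^ r) x = ∞
  · rw [hM, ENNReal.mul_top (by simp), ENNReal.top_rpow_of_pos (by positivity)]
    exact le_top
  set f : Ed d → ℝ≥0∞ := fun y => ‖u (t⁻¹ • y)‖ₑ with hf
  have hfm : Measurable f := by
    have := hu.continuous
    exact Continuous.measurable (by fun_prop)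
  have hrep : ∀ K y, f y ≤ c K / ‖∫ y, G y‖ₑ * polyAvg K f y := fun K y => by
    have h := hG t ht u hu.continuous A N hA (fun φ hφ0 => (hφ φ hφ0).2) (t⁻¹ • y)
    have h' : f y * ‖∫ y, G y‖ₑ ≤ c K * polyAvg K f y := by
      rw [polyAvg, ← lintegral_const_mul _ (by fun_prop)]
      simp only [hf]
      rw [← enorm_mul, h]
      refine (enorm_integral_le_lintegral_enorm _).trans (lintegral_mono fun w => ?_)
      rw [enorm_mul, ← smul_add, mul_left_comm]
      gcongr
      exact hc K w
    calc f y ≤ c K * polyAvg K f y / ‖∫ y, G y‖ₑ :=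
          (ENNReal.le_div_iff_mul_le (.inl hG0') (.inl enorm_ne_top)).2 h'
      _ = _ := by rw [ENNReal.mul_div_right_comm]
  have hgrow : ∀ y, f y ≤ ENNReal.ofReal (A * (1 + t⁻¹) ^ N) * polyWeight y ^ N := fun y => by
    have h := growth_dilate_le hA (inv_pos.2 ht).le 0 y
    have hA0 : 0 ≤ A := by simpa using (norm_nonneg _).trans (hA 0)
    rw [polyWeight_eq_ofReal, ← ENNReal.ofReal_pow (by positivity),
      ← ENNReal.ofReal_mul (by positivity)]
    simp only [hf]
    rw [← ofReal_norm]
    refine ENNReal.ofReal_le_ofReal ?_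
    simpa using h
  have hQ := ballSup_dilate_le_maxFn u r hr ht x
  have key := hmain f hfm hrep _ N ENNReal.ofReal_ne_top hgrow (t • x) (t • z)
    (ne_top_of_le_ne_top hM hQ)
  have hfu : f (t • x - t • z) = ‖u (x - z)‖ₑ := by
    simp only [hf]
    rw [← smul_sub, inv_smul_smul₀ ht.ne']
  have hp : ENNReal.ofReal ((1 + t * ‖z‖) ^ ((d : ℝ) / r)) =
      (polyWeight (t • z) ^ d) ^ (1 / r) := by
    rw [polyWeight_eq_ofReal, norm_smul, Real.norm_of_nonneg ht.le, ← ENNReal.rpow_natCast,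
      ← ENNReal.rpow_mul, ENNReal.ofReal_rpow_of_nonneg (by positivity) (by positivity),
      mul_one_div]
  rw [hfu] at key
  rw [hp]
  refine ENNReal.div_le_of_le_mul ?_
  rw [← ENNReal.mul_rpow_of_nonneg _ _ hr', one_div, ENNReal.le_rpow_inv_iff hr, ← enorm_eq_nnnorm]
  calc ‖u (x - z)‖ₑ ^ r ≤ _ := key
    _ ≤ (E + 1) * polyWeight (t • z) ^ d * maxFn (fun y => ‖u y‖ ^ r) x := by
        gcongr
        exact le_self_add
    _ = _ := by ring
end

section
/- Let $1<p<\infty$ and fix $0<p_0<p$. Suppose that for all Schwartz $f$ one has $\|f\|_{2p}^2\le C\,\|f\|_p\,\|f\|_{\mathrm{BMO}}$. Then for all $q>p_0$ and all Schwartz $f$, $\|f\|_q\le C'\,\|f\|_{p_0}^{p_0/q}\,\|f\|_{\mathrm{BMO}}^{1-p_0/q}$, i.e. the BMO refinement of the Hölder interpolation inequality follows. -/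
open MeasureTheory
open scoped ENNReal

/-- The axis-parallel cube with center `x` and half side length `ρ`. -/
def cube {d : ℕ} (x : Ed d) (ρ : ℝ) : Set (Ed d) := {y | ∀ i, |y i - x i| ≤ ρ}

/-- The BMO (semi-)norm `‖f‖_{BMO} = sup_Q (1/|Q|) ∫_Q |f - f_Q|`, valued in `ℝ≥0∞`. -/
noncomputable def bmoNorm {d : ℕ} (f : Ed d → ℂ) : ℝ≥0∞ :=
  ⨆ (x : Ed d) (ρ : ℝ) (_ : 0 < ρ),
    (∫⁻ y in cube x ρ, ‖f y - ⨍ z in cube x ρ, f z ∂volume‖₊ ∂volume) / volume (cube x ρ)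

open scoped NNReal

open Real in
/-- A smooth radial function equal to `0` on `‖z‖ ≤ l` and to `1` on `l + T ≤ ‖z‖`. -/
noncomputable def radialCutoff (l T : ℝ) (z : ℂ) : ℂ :=
  (smoothTransition ((‖z‖ ^ 2 - l ^ 2) / ((l + T) ^ 2 - l ^ 2)) : ℝ)

lemma contDiff_radialCutoff (l T : ℝ) :
    ContDiff ℝ ((⊤ : ℕ∞) : WithTop ℕ∞) (radialCutoff l T) :=
  Complex.ofRealCLM.contDiff.comp <| Real.smoothTransition.contDiff.comp <|
    ((contDiff_norm_sq ℝ).sub contDiff_const).div_const _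

lemma radialCutoff_of_norm_le {l T : ℝ} (hl : 0 < l) (hT : 0 < T) {z : ℂ} (hz : ‖z‖ ≤ l) :
    radialCutoff l T z = 0 := by
  have : Real.smoothTransition ((‖z‖ ^ 2 - l ^ 2) / ((l + T) ^ 2 - l ^ 2)) = 0 := by
    refine Real.smoothTransition.zero_of_nonpos (div_nonpos_of_nonpos_of_nonneg ?_ ?_)
    · nlinarith [norm_nonneg z]
    · nlinarith
  simp [radialCutoff, this]

lemma radialCutoff_of_le_norm {l T : ℝ} (hl : 0 < l) (hT : 0 < T) {z : ℂ} (hz : l + T ≤ ‖z‖) :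
    radialCutoff l T z = 1 := by
  have : Real.smoothTransition ((‖z‖ ^ 2 - l ^ 2) / ((l + T) ^ 2 - l ^ 2)) = 1 := by
    refine Real.smoothTransition.one_of_one_le ?_
    rw [one_le_div (by nlinarith)]
    nlinarith [norm_nonneg z]
  simp [radialCutoff, this]

lemma norm_radialCutoff_le_one (l T : ℝ) (z : ℂ) : ‖radialCutoff l T z‖ ≤ 1 := by
  rw [radialCutoff, Complex.norm_real, Real.norm_of_nonneg (Real.smoothTransition.nonneg _)]
  exact Real.smoothTransition.le_one _

lemma Real.smoothTransition.exists_abs_sub_le : ∃ K : ℝ, 0 ≤ K ∧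
    ∀ x y, |smoothTransition x - smoothTransition y| ≤ K * |x - y| := by
  obtain ⟨K, hK⟩ := (Real.smoothTransition.contDiff (n := 1)).locallyLipschitz.locallyLipschitzOn
    |>.exists_lipschitzOnWith_of_compact (isCompact_Icc (a := (0 : ℝ)) (b := 1))
  refine ⟨K, K.2, fun x y => ?_⟩
  have h := hK.dist_le_mul _ (Set.projIcc (0 : ℝ) 1 zero_le_one x).2 _
    (Set.projIcc (0 : ℝ) 1 zero_le_one y).2
  rw [Real.smoothTransition.projIcc, Real.smoothTransition.projIcc] at h
  refine h.trans (mul_le_mul_of_nonneg_left ?_ K.2)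
  exact Set.abs_projIcc_sub_projIcc zero_le_one

lemma exists_lipschitzWith_radialCutoff : ∃ K : ℝ≥0, ∀ l T : ℝ, 0 < l → 0 < T →
    LipschitzWith (2 * K / T.toNNReal) (radialCutoff l T) := by
  obtain ⟨K, hK0, hK⟩ := Real.smoothTransition.exists_abs_sub_le
  refine ⟨K.toNNReal, fun l T hl hT => LipschitzWith.of_dist_le_mul fun z w => ?_⟩
  have hlT : l ≤ l + T := by linarith
  have hD : 0 < (l + T) ^ 2 - l ^ 2 := by nlinarith
  have hclamp : ∀ z : ℂ, radialCutoff l T z = (Real.smoothTransition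
      (((Set.projIcc l (l + T) hlT ‖z‖ : ℝ) ^ 2 - l ^ 2) / ((l + T) ^ 2 - l ^ 2)) : ℝ) := by
    intro z
    rcases le_total ‖z‖ l with h | h
    · rw [radialCutoff_of_norm_le hl hT h, Set.projIcc_of_le_left _ h]
      simp [Real.smoothTransition.zero]
    rcases le_total (l + T) ‖z‖ with h' | h'
    · rw [radialCutoff_of_le_norm hl hT h', Set.projIcc_of_right_le _ h']
      simp [div_self hD.ne', Real.smoothTransition.one]
    · rw [Set.projIcc_of_mem _ ⟨h, h'⟩, radialCutoff]
  obtain ⟨a, ha⟩ : ∃ a, a = Set.projIcc l (l + T) hlT ‖z‖ := ⟨_, rfl⟩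
  obtain ⟨b, hb⟩ : ∃ b, b = Set.projIcc l (l + T) hlT ‖w‖ := ⟨_, rfl⟩
  have hab : |(a : ℝ) - b| ≤ dist z w := by
    rw [ha, hb, dist_eq_norm]
    exact (Set.abs_projIcc_sub_projIcc hlT).trans (abs_norm_sub_norm_le z w)
  rw [hclamp, hclamp, ← ha, ← hb, dist_eq_norm, ← Complex.ofReal_sub, Complex.norm_real]
  refine (hK _ _).trans ?_
  have hsum : |(a : ℝ) + b| ≤ 2 * (l + T) := by
    rw [abs_le]; constructor <;> linarith [a.2.1, a.2.2, b.2.1, b.2.2]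
  have hsq : ((a : ℝ) ^ 2 - l ^ 2) / ((l + T) ^ 2 - l ^ 2)
      - ((b : ℝ) ^ 2 - l ^ 2) / ((l + T) ^ 2 - l ^ 2)
      = (a + b) * (a - b) / ((l + T) ^ 2 - l ^ 2) := by ring
  have hbound : |((a : ℝ) + b) * (a - b) / ((l + T) ^ 2 - l ^ 2)| ≤ 2 / T * dist z w := by
    rw [abs_div, abs_mul, abs_of_pos hD, div_le_iff₀ hD]
    calc _ ≤ 2 * (l + T) * dist z w := by gcongr
      _ ≤ 2 * (2 * l + T) * dist z w := by gcongr; linarith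
      _ = _ := by field_simp; ring
  rw [hsq]
  refine (mul_le_mul_of_nonneg_left hbound hK0).trans_eq ?_
  rw [NNReal.coe_div, NNReal.coe_mul, Real.coe_toNNReal _ hT.le, Real.coe_toNNReal _ hK0,
    NNReal.coe_ofNat]
  ring

lemma isCompact_cube {d : ℕ} (x : Ed d) (ρ : ℝ) : IsCompact (cube x ρ) := by
  have h : cube x ρ = (EuclideanSpace.equiv (Fin d) ℝ).toHomeomorph ⁻¹'
      (Set.univ.pi fun i => Metric.closedBall (x i) ρ) := by
    ext y
    simp [cube, Real.dist_eq]
  rw [h, Homeomorph.isCompact_preimage]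
  exact isCompact_univ_pi fun i => isCompact_closedBall _ _

/-- The mean oscillation is at most twice the mean distance to any constant. -/
lemma lintegral_enorm_sub_average_le {α : Type*} [MeasurableSpace α] {μ : Measure α}
    [IsFiniteMeasure μ] {g : α → ℂ} (hg : Integrable g μ) (c : ℂ) :
    ∫⁻ y, ‖g y - ⨍ z, g z ∂μ‖ₑ ∂μ ≤ 2 * ∫⁻ y, ‖g y - c‖ₑ ∂μ := by
  rcases eq_zero_or_neZero μ with rfl | hμ
  · simp
  have hmean : μ Set.univ * ‖c - ⨍ z, g z ∂μ‖ₑ ≤ ∫⁻ y, ‖g y - c‖ₑ ∂μ := by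
    have h1 : μ.real Set.univ • (⨍ z, g z ∂μ - c) = ∫ y, (g y - c) ∂μ := by
      rw [integral_sub hg (integrable_const c), smul_sub, measure_smul_average, integral_const]
    have h2 : μ Set.univ = ‖μ.real Set.univ‖ₑ := by
      rw [Real.enorm_of_nonneg measureReal_nonneg, ofReal_measureReal]
    rw [h2, ← enorm_neg (c - _), neg_sub, ← enorm_smul, h1]
    exact enorm_integral_le_lintegral_enorm _
  calc ∫⁻ y, ‖g y - ⨍ z, g z ∂μ‖ₑ ∂μ
      ≤ ∫⁻ y, (‖g y - c‖ₑ + ‖c - ⨍ z, g z ∂μ‖ₑ) ∂μ := by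
        refine lintegral_mono fun y => ?_
        rw [← sub_add_sub_cancel (g y) c]
        exact enorm_add_le _ _
    _ = ∫⁻ y, ‖g y - c‖ₑ ∂μ + μ Set.univ * ‖c - ⨍ z, g z ∂μ‖ₑ := by
        rw [lintegral_add_right _ measurable_const, lintegral_const, mul_comm (μ _)]
    _ ≤ _ := by rw [two_mul]; gcongr

lemma bmoNorm_comp_le {d : ℕ} {f : Ed d → ℂ} (hf : Continuous f) {φ : ℂ → ℂ} {L : ℝ≥0}
    (hφ : LipschitzWith L φ) : bmoNorm (φ ∘ f) ≤ 2 * L * bmoNorm f := by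
  refine iSup_le fun x => iSup_le fun ρ => iSup_le fun hρ => ?_
  have hQ := isCompact_cube x ρ
  have : IsFiniteMeasure (volume.restrict (cube x ρ)) :=
    ⟨by simpa using hQ.measure_lt_top⟩
  have hint : Integrable (φ ∘ f) (volume.restrict (cube x ρ)) :=
    (hφ.continuous.comp hf).continuousOn.integrableOn_compact hQ
  have hosc : ∫⁻ y in cube x ρ, ‖(φ ∘ f) y - ⨍ z in cube x ρ, (φ ∘ f) z‖ₑ ≤
      2 * L * ∫⁻ y in cube x ρ, ‖f y - ⨍ z in cube x ρ, f z‖ₑ := by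
    refine (lintegral_enorm_sub_average_le hint (φ (⨍ z in cube x ρ, f z))).trans ?_
    rw [mul_assoc, ← lintegral_const_mul' _ _ ENNReal.coe_ne_top]
    gcongr with y
    simpa [edist_eq_enorm_sub] using hφ (f y) (⨍ z in cube x ρ, f z)
  refine (ENNReal.div_le_div_right hosc _).trans ?_
  rw [mul_div_assoc]
  gcongr
  exact le_iSup_of_le x (le_iSup_of_le ρ (le_iSup_of_le hρ le_rfl))

/-- Testing the hypothesis against a smooth cutoff of `f` between the heights `l` and `l + T`
shows that the distribution function of `f` halves when the height grows by `T`. -/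
lemma measure_superlevel_decay {d : ℕ} {p C : ℝ} (hp : 1 < p) (hC : 0 ≤ C)
    (H : ∀ f : SchwartzMap (Ed d) ℂ,
      (eLpNorm (⇑f) (ENNReal.ofReal (2 * p)) volume) ^ 2 ≤
        ENNReal.ofReal C * eLpNorm (⇑f) (ENNReal.ofReal p) volume * bmoNorm (⇑f))
    {K : ℝ≥0} (hK : ∀ l T : ℝ, 0 < l → 0 < T →
      LipschitzWith (2 * K / T.toNNReal) (radialCutoff l T))
    (f : SchwartzMap (Ed d) ℂ) {b : ℝ} (hb : bmoNorm f = ENNReal.ofReal b)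
    {l T : ℝ} (hl : 0 < l) (hT : 0 < T) (hbT : 8 * C * K * b ≤ T) :
    volume {x | l + T ≤ ‖f x‖} ≤ ENNReal.ofReal (1 / 2) * volume {x | l ≤ ‖f x‖} := by
  have hp0 : 0 < p := by linarith
  have hzero : ∀ x, ‖f x‖ ≤ l → radialCutoff l T (f x) = 0 := fun x =>
    radialCutoff_of_norm_le hl hT
  have hcs : HasCompactSupport (radialCutoff l T ∘ f) := by
    have := (f.tendsto_cocompact).norm
    rw [norm_zero] at this
    obtain ⟨t, ht, hts⟩ := Filter.mem_cocompact.1 (this.eventually_lt_const hl)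
    refine HasCompactSupport.intro ht fun x hx => hzero x (le_of_lt (hts hx))
  set g : SchwartzMap (Ed d) ℂ :=
    hcs.toSchwartzMap ((contDiff_radialCutoff l T).comp f.smooth')
  have hg : (g : Ed d → ℂ) = radialCutoff l T ∘ f := rfl
  have hmeas : ∀ r, MeasurableSet {x | r ≤ ‖f x‖} := fun r =>
    measurableSet_le measurable_const f.continuous.norm.measurable
  have hE : ∀ r : ℝ, 0 < r → eLpNorm g (ENNReal.ofReal r) volume =
      (∫⁻ x, ‖radialCutoff l T (f x)‖ₑ ^ r) ^ (1 / r) := by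
    intro r hr
    rw [eLpNorm_eq_lintegral_rpow_enorm_toReal (by simpa using hr) ENNReal.ofReal_ne_top,
      ENNReal.toReal_ofReal hr.le, hg]
    rfl
  have hlow : volume {x | l + T ≤ ‖f x‖} ^ (1 / p) ≤
      (eLpNorm g (ENNReal.ofReal (2 * p)) volume) ^ 2 := by
    rw [hE _ (by positivity), ← ENNReal.rpow_two, ← ENNReal.rpow_mul,
      show 1 / (2 * p) * 2 = 1 / p by field_simp, ← lintegral_indicator_one (hmeas _)]
    gcongr with x
    refine Set.indicator_apply_le' (fun hx => ?_) (fun _ => zero_le)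
    rw [radialCutoff_of_le_norm hl hT hx]
    simp
  have hup : eLpNorm g (ENNReal.ofReal p) volume ≤ volume {x | l ≤ ‖f x‖} ^ (1 / p) := by
    rw [hE _ hp0, ← lintegral_indicator_one (hmeas _)]
    gcongr with x
    by_cases hx : l ≤ ‖f x‖
    · rw [Set.indicator_of_mem (by exact hx)]
      refine ENNReal.rpow_le_one ?_ hp0.le
      rw [← ofReal_norm]
      exact ENNReal.ofReal_le_one.2 (norm_radialCutoff_le_one _ _ _)
    · rw [hzero x (le_of_not_ge hx)]
      simp [hp0]
  have hbmo : ENNReal.ofReal C * bmoNorm g ≤ ENNReal.ofReal (1 / 2) := by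
    rw [hg]
    refine (mul_le_mul_right (bmoNorm_comp_le f.continuous (hK l T hl hT)) _).trans ?_
    rw [hb, show (2 * ((2 * K / T.toNNReal : ℝ≥0) : ℝ≥0∞)) = ENNReal.ofReal (4 * K / T) by
      rw [← ENNReal.ofReal_coe_nnreal, ← ENNReal.ofReal_ofNat, ← ENNReal.ofReal_mul (by norm_num)]
      congr 1
      simp only [NNReal.coe_div, NNReal.coe_mul, NNReal.coe_ofNat, Real.coe_toNNReal _ hT.le]
      ring, ← ENNReal.ofReal_mul (by positivity), ← ENNReal.ofReal_mul hC]
    refine ENNReal.ofReal_le_ofReal ?_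
    rw [show C * (4 * K / T * b) = (8 * C * K * b) / T / 2 by ring]
    have := (div_le_one hT).2 hbT
    linarith
  have hmain : volume {x | l + T ≤ ‖f x‖} ^ (1 / p) ≤
      ENNReal.ofReal (1 / 2) * volume {x | l ≤ ‖f x‖} ^ (1 / p) := by
    refine (hlow.trans (H g)).trans ?_
    rw [mul_right_comm]
    gcongr
  have hpow := ENNReal.rpow_le_rpow hmain hp0.le
  rw [ENNReal.mul_rpow_of_nonneg _ _ hp0.le, ← ENNReal.rpow_mul, ← ENNReal.rpow_mul,
    one_div_mul_cancel hp0.ne', ENNReal.rpow_one, ENNReal.rpow_one] at hpow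
  refine hpow.trans ?_
  gcongr
  rw [ENNReal.ofReal_rpow_of_nonneg (by norm_num) hp0.le]
  refine ENNReal.ofReal_le_ofReal ?_
  simpa using Real.rpow_le_rpow_of_exponent_ge (by norm_num : (0 : ℝ) < 1 / 2) (by norm_num) hp.le

lemma summable_rpow_mul_half_pow (q : ℝ) :
    Summable fun k : ℕ => ((k : ℝ) + 3) ^ q * (1 / 2) ^ (k + 1) := by
  obtain ⟨n, hn⟩ := exists_nat_ge q
  have h := (summable_nat_add_iff 3).2
    (summable_pow_mul_geometric_of_norm_lt_one n (r := (1 / 2 : ℝ)) (by norm_num))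
  refine Summable.of_nonneg_of_le (fun k => by positivity) (fun k => ?_) (h.mul_left 4)
  have h1 : ((k : ℝ) + 3) ^ q ≤ ((k : ℝ) + 3) ^ n := by
    rw [← Real.rpow_natCast]
    exact Real.rpow_le_rpow_of_exponent_le (by linarith [k.cast_nonneg (α := ℝ)]) hn
  calc _ ≤ ((k : ℝ) + 3) ^ n * (1 / 2) ^ (k + 1) := by gcongr
    _ = _ := by push_cast; ring

/-- If the distribution function of `u` halves on each step of length `T`, then the higher
moments of `u` are controlled by the lower ones. -/
lemma exists_lintegral_rpow_le_of_decay {p₀ q : ℝ} (hp₀ : 0 < p₀) (hq : p₀ < q) :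
    ∃ M : ℝ, 0 < M ∧ ∀ {α : Type} [MeasurableSpace α] (μ : Measure α) (u : α → ℝ),
      Measurable u → (∀ x, 0 ≤ u x) → ∀ T : ℝ, 0 < T →
      (∀ l, 0 < l → μ {x | l + T ≤ u x} ≤ ENNReal.ofReal (1 / 2) * μ {x | l ≤ u x}) →
      ∫⁻ x, ENNReal.ofReal (u x ^ q) ∂μ ≤
        ENNReal.ofReal (M * (T ^ (q - p₀))) * ∫⁻ x, ENNReal.ofReal (u x ^ p₀) ∂μ := by
  have hsum := summable_rpow_mul_half_pow q
  refine ⟨2 ^ (q - p₀) + ∑' k : ℕ, ((k : ℝ) + 3) ^ q * (1 / 2) ^ (k + 1),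
    add_pos_of_pos_of_nonneg (by positivity) (tsum_nonneg fun k => by positivity), ?_⟩
  intro α _ μ u hu hu0 T hT hdecay
  have hq0 : 0 < q := hp₀.trans hq
  set I := ∫⁻ x, ENNReal.ofReal (u x ^ p₀) ∂μ
  have hmeas : ∀ r, MeasurableSet {x | r ≤ u x} := fun r => measurableSet_le measurable_const hu
  have hmarkov : ENNReal.ofReal (T ^ p₀) * μ {x | T ≤ u x} ≤ I := by
    refine le_trans ?_ (mul_meas_ge_le_lintegral (hu.pow_const p₀).ennreal_ofReal
      (ENNReal.ofReal (T ^ p₀)))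
    gcongr with x
    intro hx
    exact ENNReal.ofReal_le_ofReal (Real.rpow_le_rpow hT.le hx hp₀.le)
  have hgeom : ∀ k : ℕ, μ {x | (k + 1) * T ≤ u x} ≤
      ENNReal.ofReal ((1 / 2) ^ k) * μ {x | T ≤ u x} := by
    intro k
    induction k with
    | zero => simp
    | succ k ih =>
      have := hdecay ((k + 1) * T) (by positivity)
      rw [show ((k : ℝ) + 1) * T + T = ((k + 1 : ℕ) + 1) * T by push_cast; ring] at this
      refine (this.trans (mul_le_mul_right ih _)).trans_eq ?_
      rw [← mul_assoc, ← ENNReal.ofReal_mul (by norm_num), pow_succ']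
  have hpt : ∀ x, ENNReal.ofReal (u x ^ q) ≤
      ENNReal.ofReal ((2 * T) ^ (q - p₀)) * ENNReal.ofReal (u x ^ p₀) +
      ∑' k : ℕ, {x | ((k + 1 : ℕ) + 1) * T ≤ u x}.indicator
        (fun _ => ENNReal.ofReal (((k + 3) * T) ^ q)) x := by
    intro x
    rcases le_or_gt (u x) (2 * T) with h | h
    · refine le_add_right ?_
      rw [← ENNReal.ofReal_mul (by positivity)]
      refine ENNReal.ofReal_le_ofReal ?_
      rcases (hu0 x).eq_or_lt with h0 | h0
      · rw [← h0, Real.zero_rpow hq0.ne', Real.zero_rpow hp₀.ne', mul_zero]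
      · calc u x ^ q = u x ^ (q - p₀) * u x ^ p₀ := by
              rw [← Real.rpow_add h0, sub_add_cancel]
          _ ≤ _ := by
              gcongr
    · refine le_add_left (le_trans ?_ (ENNReal.le_tsum (⌊u x / T⌋₊ - 2)))
      have h2 : 2 ≤ ⌊u x / T⌋₊ := Nat.le_floor (by rw [le_div_iff₀ hT]; exact_mod_cast h.le)
      obtain ⟨k, hk⟩ := Nat.exists_eq_add_of_le' h2
      have hlo := Nat.floor_le (div_nonneg (hu0 x) hT.le)
      have hhi := Nat.lt_floor_add_one (u x / T)
      rw [hk] at hlo hhi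
      rw [le_div_iff₀ hT] at hlo
      rw [div_lt_iff₀ hT] at hhi
      push_cast at hlo hhi
      rw [hk, Nat.add_sub_cancel, Set.indicator_of_mem]
      · refine ENNReal.ofReal_le_ofReal (Real.rpow_le_rpow (hu0 x) ?_ hq0.le)
        linarith
      · simp only [Set.mem_ofPred_eq]
        push_cast
        linarith
  have hterm : ∀ k : ℕ, ENNReal.ofReal (((k + 3) * T) ^ q) *
      μ {x | ((k + 1 : ℕ) + 1) * T ≤ u x} ≤
      ENNReal.ofReal (((k : ℝ) + 3) ^ q * (1 / 2) ^ (k + 1)) *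
        (ENNReal.ofReal (T ^ (q - p₀)) * I) := by
    intro k
    calc _ ≤ ENNReal.ofReal (((k + 3) * T) ^ q) *
          (ENNReal.ofReal ((1 / 2) ^ (k + 1)) * μ {x | T ≤ u x}) := by
          gcongr
          exact hgeom (k + 1)
      _ = ENNReal.ofReal (((k : ℝ) + 3) ^ q * (1 / 2) ^ (k + 1)) *
          (ENNReal.ofReal (T ^ (q - p₀)) * (ENNReal.ofReal (T ^ p₀) * μ {x | T ≤ u x})) := by
          simp only [← mul_assoc]
          rw [← ENNReal.ofReal_mul (by positivity), ← ENNReal.ofReal_mul (by positivity),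
            ← ENNReal.ofReal_mul (by positivity)]
          congr 2
          rw [mul_assoc, ← Real.rpow_add hT, sub_add_cancel,
            Real.mul_rpow (by positivity) hT.le]
          ring
      _ ≤ _ := by gcongr
  calc _ ≤ _ := lintegral_mono hpt
    _ = ENNReal.ofReal ((2 * T) ^ (q - p₀)) * I + ∑' k : ℕ, ENNReal.ofReal (((k + 3) * T) ^ q) *
          μ {x | ((k + 1 : ℕ) + 1) * T ≤ u x} := by
        rw [lintegral_add_left ((hu.pow_const p₀).ennreal_ofReal.const_mul _),
          lintegral_const_mul _ (hu.pow_const p₀).ennreal_ofReal,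
          lintegral_tsum fun k => (measurable_const.indicator (hmeas _)).aemeasurable]
        simp_rw [lintegral_indicator_const (hmeas _)]
        rfl
    _ ≤ ENNReal.ofReal ((2 * T) ^ (q - p₀)) * I +
          ∑' k : ℕ, ENNReal.ofReal (((k : ℝ) + 3) ^ q * (1 / 2) ^ (k + 1)) *
            (ENNReal.ofReal (T ^ (q - p₀)) * I) := by
        exact add_le_add_right (ENNReal.tsum_le_tsum hterm) _
    _ = _ := by
        rw [ENNReal.tsum_mul_right,
          ← ENNReal.ofReal_tsum_of_nonneg (fun k => by positivity) hsum, add_mul,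
          ENNReal.ofReal_add (by positivity)
            (mul_nonneg (tsum_nonneg fun k => by positivity) (by positivity)), add_mul,
          Real.mul_rpow (by norm_num) hT.le,
          ENNReal.ofReal_mul (tsum_nonneg fun k => by positivity), mul_assoc]

/-- If `‖f‖_{2p}² ≤ C ‖f‖_p ‖f‖_{BMO}` for all Schwartz `f`, then for every
`q > p₀` one has the BMO refinement `‖f‖_q ≤ C' ‖f‖_{p₀}^{p₀/q} ‖f‖_{BMO}^{1-p₀/q}`. -/
theorem stmt8 {d : ℕ} (hd : 1 ≤ d) (p p₀ C : ℝ) (hp : 1 < p) (hp₀ : 0 < p₀) (hp₀p : p₀ < p)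
    (hC : 0 ≤ C)
    (H : ∀ f : SchwartzMap (Ed d) ℂ,
      (eLpNorm (⇑f) (ENNReal.ofReal (2 * p)) volume) ^ 2 ≤
        ENNReal.ofReal C * eLpNorm (⇑f) (ENNReal.ofReal p) volume * bmoNorm (⇑f)) :
    ∀ q : ℝ, p₀ < q → ∃ C' : ℝ, 0 ≤ C' ∧ ∀ f : SchwartzMap (Ed d) ℂ,
      eLpNorm (⇑f) (ENNReal.ofReal q) volume ≤
        ENNReal.ofReal C' * (eLpNorm (⇑f) (ENNReal.ofReal p₀) volume) ^ (p₀ / q) *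
          (bmoNorm (⇑f)) ^ (1 - p₀ / q) := by
  obtain ⟨K, hK⟩ := exists_lipschitzWith_radialCutoff
  intro q hq
  have hq0 : 0 < q := hp₀.trans hq
  have hr : 0 < 1 - p₀ / q := sub_pos.2 ((div_lt_one hq0).2 hq)
  obtain ⟨M, hM0, hM⟩ := exists_lintegral_rpow_le_of_decay hp₀ hq
  set A : ℝ := 8 * C * K + 1 with hA
  have hA0 : 0 < A := by positivity
  refine ⟨M ^ (1 / q) * A ^ (1 - p₀ / q), by positivity, fun f => ?_⟩
  by_cases hB0 : bmoNorm f = 0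
  · have h0 : eLpNorm f (ENNReal.ofReal (2 * p)) volume = 0 := by
      have := H f
      rw [hB0, mul_zero] at this
      exact pow_eq_zero_iff two_ne_zero |>.1 (le_antisymm this zero_le)
    rw [eLpNorm_eq_zero_iff f.continuous.aestronglyMeasurable
      (by simpa using by linarith)] at h0
    rw [eLpNorm_congr_ae h0, eLpNorm_zero]
    exact zero_le
  by_cases hf0 : eLpNorm f (ENNReal.ofReal p₀) volume = 0
  · rw [eLpNorm_eq_zero_iff f.continuous.aestronglyMeasurable
      (by simpa using hp₀)] at hf0
    rw [eLpNorm_congr_ae hf0, eLpNorm_zero]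
    exact zero_le
  by_cases hBt : bmoNorm f = ∞
  · rw [hBt, ENNReal.top_rpow_of_pos hr, ENNReal.mul_top]
    · exact le_top
    · refine mul_ne_zero (ENNReal.ofReal_pos.2 (by positivity)).ne' ?_
      rw [Ne, ENNReal.rpow_eq_zero_iff_of_pos (by positivity)]
      exact hf0
  obtain ⟨b, hb⟩ : ∃ b : ℝ, bmoNorm f = ENNReal.ofReal b :=
    ⟨_, (ENNReal.ofReal_toReal hBt).symm⟩
  have hb0 : 0 < b := by
    rw [hb] at hB0
    exact ENNReal.ofReal_pos.1 (pos_iff_ne_zero.2 hB0)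
  have hT : 0 < A * b := by positivity
  have key := hM (volume : Measure (Ed d)) (fun x => ‖f x‖) f.continuous.norm.measurable
    (fun x => norm_nonneg _) (A * b) hT (fun l hl =>
      measure_superlevel_decay hp hC H hK f hb hl hT (by rw [hA]; nlinarith))
  have hE : ∀ r : ℝ, 0 < r → eLpNorm f (ENNReal.ofReal r) volume =
      (∫⁻ x, ENNReal.ofReal (‖f x‖ ^ r)) ^ (1 / r) := by
    intro r hr
    rw [eLpNorm_eq_lintegral_rpow_enorm_toReal (by simpa using hr) ENNReal.ofReal_ne_top,
      ENNReal.toReal_ofReal hr.le]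
    simp_rw [← ofReal_norm, ENNReal.ofReal_rpow_of_nonneg (norm_nonneg _) hr.le]
  rw [hE q hq0, hE p₀ hp₀, hb, ← ENNReal.rpow_mul]
  calc _ ≤ _ := ENNReal.rpow_le_rpow key (by positivity)
    _ = _ := by
      rw [ENNReal.mul_rpow_of_nonneg _ _ (by positivity),
        ENNReal.ofReal_rpow_of_nonneg (by positivity) (by positivity),
        ENNReal.ofReal_rpow_of_nonneg hb0.le hr.le, mul_right_comm,
        ← ENNReal.ofReal_mul (by positivity), Real.mul_rpow hM0.le (by positivity),
        ← Real.rpow_mul hT.le, mul_assoc (M ^ (1 / q)), ← Real.mul_rpow hA0.le hb0.le]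
      congr 4 <;> field_simp
end
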